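/- arXiv:1507.08926 — 2 statements merged into one kernel-verified Lean document; each statement's English description precedes it below -/
import Mathlib

section
/- Let k, ℓ, t ≥ 2, let 0 < m < ℓ, and set r = (k−1)ℓ + m. In the group G = (Z_t)^r ⋊ Z_r (cyclic-shift action), let S consist of the t^ℓ 'long' elements (a_1,...,a_ℓ,0,...,0;ℓ) with a_i ∈ Z_t, together with the 'short' elements (a_1,...,a_m,0,...,0;s) with a_i ∈ Z_t and s ∈ Z_r, s ≠ ℓ. Then |S| = t^ℓ + (r−1)t^m − 1 (excluding the identity) and every element of G is a product of at most k elements of S. -/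
/-- The cyclic right-shift by `s` on vectors in `(ZMod t)^r`
(indices in `ZMod r`; coordinate `j` of the paper is index `j-1`). -/
def shiftEquiv (t r : ℕ) (s : ZMod r) : (ZMod r → ZMod t) ≃+ (ZMod r → ZMod t) where
  toFun v := fun i => v (i - s)
  invFun v := fun i => v (i + s)
  left_inv v := funext fun i => by simp
  right_inv v := funext fun i => by simp
  map_add' u v := rfl

/-- The action of `ZMod r` on `(ZMod t)^r` by cyclic right shifts. -/
def shiftHom (t r : ℕ) :
    Multiplicative (ZMod r) →* MulAut (Multiplicative (ZMod r → ZMod t)) where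
  toFun s := AddEquiv.toMultiplicative (shiftEquiv t r (Multiplicative.toAdd s))
  map_one' := by
    ext v
    simp [shiftEquiv]
  map_mul' s s' := by
    ext v
    simp [shiftEquiv, sub_sub]

/-- The group `G = (Z_t)^r ⋊ Z_r` of the paper, with multiplication
`(u,s)·(v,s') = (u + α^s(v), s+s')`. -/
abbrev DBGroup (t r : ℕ) : Type :=
  SemidirectProduct (Multiplicative (ZMod r → ZMod t)) (Multiplicative (ZMod r)) (shiftHom t r)

/-- The element `(v; s)` of `G`. -/
def DBGroup.mk' (t r : ℕ) (v : ZMod r → ZMod t) (s : ZMod r) : DBGroup t r :=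
  ⟨Multiplicative.ofAdd v, Multiplicative.ofAdd s⟩

/-- `v` is supported on the first `m` coordinates, i.e. on the indices
`0, 1, …, m-1` of `ZMod r` (paper coordinates `1,…,m`). -/
def SupportedOn (t r m : ℕ) (v : ZMod r → ZMod t) : Prop :=
  ∀ i : ZMod r, v i ≠ 0 → ∃ j : ℕ, j < m ∧ i = (j : ZMod r)


theorem card_supportedOn (t r n : ℕ) [NeZero r] (hn : n ≤ r) :
    Nat.card {v : ZMod r → ZMod t // SupportedOn t r n v} = t ^ n := by
  classical
  have hb : Function.Bijective
      (fun (v : {v : ZMod r → ZMod t // SupportedOn t r n v}) (j : Fin n) =>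
        v.1 ((j : ℕ) : ZMod r)) := by
    constructor
    · rintro ⟨v, hv⟩ ⟨w, hw⟩ h
      apply Subtype.ext
      funext i
      by_cases hi : ∃ j : ℕ, j < n ∧ i = (j : ZMod r)
      · obtain ⟨j, hj, rfl⟩ := hi
        exact congrFun h ⟨j, hj⟩
      · have h1 : v i = 0 := by
          by_contra h0
          exact hi (hv i h0)
        have h2 : w i = 0 := by
          by_contra h0
          exact hi (hw i h0)
        show v i = w i
        rw [h1, h2]
    · intro f
      refine ⟨⟨fun i => if h : i.val < n then f ⟨i.val, h⟩ else 0, ?_⟩, ?_⟩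
      · intro i hi
        by_cases h : i.val < n
        · exact ⟨i.val, h, (ZMod.natCast_zmod_val i).symm⟩
        · simp [h] at hi
      · funext j
        have : ((j : ℕ) : ZMod r).val = j := ZMod.val_cast_of_lt (lt_of_lt_of_le j.2 hn)
        simp [this]
  rw [Nat.card_congr (Equiv.ofBijective _ hb), Nat.card_fun]
  simp

/-- Long or short elements, with the identity allowed. -/
def bigSet (t r ℓ m : ℕ) : Set (DBGroup t r) :=
  {x | (Multiplicative.toAdd x.right = (ℓ : ZMod r) ∧
            SupportedOn t r ℓ (Multiplicative.toAdd x.left)) ∨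
         (Multiplicative.toAdd x.right ≠ (ℓ : ZMod r) ∧
            SupportedOn t r m (Multiplicative.toAdd x.left))}

theorem card_bigSet (t r ℓ m : ℕ) [NeZero r] (ht : t ≠ 0) (hl : ℓ ≤ r) (hm : m ≤ r) :
    Nat.card (bigSet t r ℓ m) = t ^ ℓ + (r - 1) * t ^ m := by
  classical
  let F : {v : ZMod r → ZMod t // SupportedOn t r ℓ v} ⊕
      ({s : ZMod r // s ≠ (ℓ : ZMod r)} × {v : ZMod r → ZMod t // SupportedOn t r m v}) →
      bigSet t r ℓ m := fun x => match x with
    | Sum.inl v => ⟨DBGroup.mk' t r v.1 (ℓ : ZMod r), Or.inl ⟨rfl, v.2⟩⟩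
    | Sum.inr p => ⟨DBGroup.mk' t r p.2.1 p.1.1, Or.inr ⟨p.1.2, p.2.2⟩⟩
  have key : ∀ v w : ZMod r → ZMod t, ∀ s s' : ZMod r,
      DBGroup.mk' t r v s = DBGroup.mk' t r w s' → v = w ∧ s = s' := by
    intro v w s s' h
    exact ⟨congrArg (fun x : DBGroup t r => Multiplicative.toAdd x.left) h,
      congrArg (fun x : DBGroup t r => Multiplicative.toAdd x.right) h⟩
  have hF : Function.Bijective F := by
    constructor
    · rintro (⟨v, hv⟩ | ⟨⟨s, hs⟩, ⟨v, hv⟩⟩) (⟨w, hw⟩ | ⟨⟨s', hs'⟩, ⟨w, hw⟩⟩) h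
      · obtain ⟨h1, h2⟩ := key _ _ _ _ (congrArg Subtype.val h)
        subst h1
        rfl
      · obtain ⟨h1, h2⟩ := key _ _ _ _ (congrArg Subtype.val h)
        exact absurd h2.symm hs'
      · obtain ⟨h1, h2⟩ := key _ _ _ _ (congrArg Subtype.val h)
        exact absurd h2 hs
      · obtain ⟨h1, h2⟩ := key _ _ _ _ (congrArg Subtype.val h)
        subst h1
        subst h2
        rfl
    · rintro ⟨x, hx⟩
      rcases hx with ⟨h1, h2⟩ | ⟨h1, h2⟩
      · refine ⟨Sum.inl ⟨_, h2⟩, Subtype.ext ?_⟩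
        exact SemidirectProduct.ext rfl h1.symm
      · exact ⟨Sum.inr ⟨⟨_, h1⟩, ⟨_, h2⟩⟩, rfl⟩
  have : NeZero t := ⟨ht⟩
  have : Finite (ZMod r → ZMod t) := inferInstance
  rw [← Nat.card_congr (Equiv.ofBijective F hF)]
  rw [Nat.card_sum, Nat.card_prod, card_supportedOn t r ℓ hl, card_supportedOn t r m hm]
  have hc : Nat.card {s : ZMod r // s ≠ (ℓ : ZMod r)} = r - 1 := by
    rw [Nat.card_eq_fintype_card, Fintype.card_subtype_compl, ZMod.card]
    simp
  rw [hc]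

theorem bigSet_gen (t r ℓ m : ℕ) (hmℓ : m ≤ ℓ) (n : ℕ) :
    ∀ (u : ZMod r → ZMod t) (s : ZMod r), SupportedOn t r (n * ℓ + m) u →
      ∃ l : List (DBGroup t r), (∀ x ∈ l, x ∈ bigSet t r ℓ m) ∧ l.length ≤ n + 1 ∧
        l.prod = DBGroup.mk' t r u s := by
  classical
  induction n with
  | zero =>
    intro u s hu
    refine ⟨[DBGroup.mk' t r u s], ?_, by simp, by simp⟩
    intro x hx
    rw [List.mem_singleton] at hx
    subst hx
    rw [zero_mul, zero_add] at hu
    by_cases hs : s = (ℓ : ZMod r)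
    · refine Or.inl ⟨hs, fun i hi => ?_⟩
      obtain ⟨j, hj, h⟩ := hu i hi
      exact ⟨j, by omega, h⟩
    · exact Or.inr ⟨hs, hu⟩
  | succ n ih =>
    intro u s hu
    let P : ZMod r → Prop := fun i => ∃ j : ℕ, j < ℓ ∧ i = (j : ZMod r)
    let u1 : ZMod r → ZMod t := fun i => if P i then u i else 0
    let v : ZMod r → ZMod t := fun i => if P (i + ℓ) then 0 else u (i + ℓ)
    have hv : SupportedOn t r (n * ℓ + m) v := by
      intro i hi
      by_cases hP : P (i + ℓ)
      · simp [v, hP] at hi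
      · simp only [v, hP, if_false] at hi
        obtain ⟨j, hj, h⟩ := hu _ hi
        have hjl : ℓ ≤ j := by
          by_contra hlt
          exact hP ⟨j, by omega, h⟩
        refine ⟨j - ℓ, ?_, ?_⟩
        · rw [add_mul, one_mul] at hj
          omega
        · rw [Nat.cast_sub hjl, ← h]
          ring
    obtain ⟨l, h1, h2, h3⟩ := ih v (s - ℓ) hv
    refine ⟨DBGroup.mk' t r u1 ℓ :: l, ?_, by simpa using h2, ?_⟩
    · intro x hx
      rcases List.mem_cons.1 hx with rfl | hx
      · refine Or.inl ⟨rfl, fun i hi => ?_⟩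
        by_contra hP
        apply hi
        show (if P i then u i else 0) = 0
        exact if_neg hP
      · exact h1 x hx
    · rw [List.prod_cons, h3]
      refine SemidirectProduct.ext ?_ ?_
      · show u1 + (fun i => v (i - ℓ)) = u
        funext i
        by_cases hP : P i <;> simp [u1, v, hP]
      · show (ℓ : ZMod r) + (s - ℓ) = s
        ring

/-- Theorem 3 (second directed construction): in `G = (Z_t)^r ⋊ Z_r` with
`r = (k-1)ℓ + m`, the set `S` of long elements `(a₁,…,a_ℓ,0,…,0; ℓ)` and of short
elements `(a₁,…,a_m,0,…,0; s)`, `s ≠ ℓ`, excluding the identity, has cardinality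
`t^ℓ + (r-1)t^m - 1`, and every element of `G` is a product of at most `k`
elements of `S`. -/
theorem dbGroup_second_construction_directed (k ℓ t m r : ℕ)
    (hk : 2 ≤ k) (hl : 2 ≤ ℓ) (ht : 2 ≤ t) (hm0 : 0 < m) (hml : m < ℓ)
    (hr : r = (k - 1) * ℓ + m)
    (S : Set (DBGroup t r))
    (hS : S = {x | x ≠ 1 ∧
        ((Multiplicative.toAdd x.right = (ℓ : ZMod r) ∧
            SupportedOn t r ℓ (Multiplicative.toAdd x.left)) ∨
         (Multiplicative.toAdd x.right ≠ (ℓ : ZMod r) ∧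
            SupportedOn t r m (Multiplicative.toAdd x.left)))}) :
    Nat.card S = t ^ ℓ + (r - 1) * t ^ m - 1 ∧
    ∀ g : DBGroup t r,
      ∃ l : List (DBGroup t r), (∀ x ∈ l, x ∈ S) ∧ l.length ≤ k ∧ l.prod = g := by
  classical
  have hkl : ℓ ≤ (k - 1) * ℓ := Nat.le_mul_of_pos_left _ (by omega)
  have hlr : ℓ < r := by omega
  have : NeZero r := ⟨by omega⟩
  have hl0 : (0 : ZMod r) ≠ (ℓ : ZMod r) := by
    intro h
    have := congrArg ZMod.val h
    rw [ZMod.val_cast_of_lt hlr, ZMod.val_zero] at this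
    omega
  have hST : S = bigSet t r ℓ m \ {1} := by
    rw [hS]
    ext x
    exact ⟨fun h => ⟨h.2, h.1⟩, fun h => ⟨h.2, h.1⟩⟩
  have h1 : (1 : DBGroup t r) ∈ bigSet t r ℓ m :=
    Or.inr ⟨hl0, fun i hi => absurd rfl hi⟩
  constructor
  · rw [hST, Nat.card_coe_set_eq, Set.ncard_sdiff_singleton_of_mem h1, ← Nat.card_coe_set_eq,
      card_bigSet t r ℓ m (by omega) hlr.le (by omega)]
  · intro g
    obtain ⟨l, h2, h3, h4⟩ := bigSet_gen t r ℓ m hml.le (k - 1)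
      (Multiplicative.toAdd g.left) (Multiplicative.toAdd g.right) (by
        intro i _
        exact ⟨i.val, hr ▸ ZMod.val_lt i, (ZMod.natCast_zmod_val i).symm⟩)
    refine ⟨l.filter (fun x => x ≠ 1), ?_, ?_, ?_⟩
    · intro x hx
      rw [List.mem_filter] at hx
      rw [hST]
      exact ⟨h2 x hx.1, by simpa using hx.2⟩
    · have := List.length_filter_le (fun x : DBGroup t r => decide (x ≠ 1)) l
      omega
    · have h5 : ∀ l : List (DBGroup t r), (l.filter (fun x => x ≠ 1)).prod = l.prod := by
        intro l
        induction l with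
        | nil => rfl
        | cons a l ih =>
          by_cases ha : a = 1
          · simpa [List.filter_cons, ha] using ih
          · simpa [List.filter_cons, ha] using ih
      rw [h5, h4]
      rfl
end

section
/- For any k ≥ 3, there are arbitrarily large values of d for which there exists a group G and a generating set S with |S| = d such that the Cayley digraph Cay(G,S) has diameter at most k and |G| ≥ (1/k)·((k/(k+2))·(d+1))^k. -/
/-- Elements of the wreath-type group `M ≀ ℤ/k`. -/
@[ext] structure WrG (k : ℕ) (M : Type) where
  fn : ZMod k → M
  sh : ZMod k

namespace WrG

variable {k : ℕ} {M : Type} [AddCommGroup M]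

instance : Mul (WrG k M) := ⟨fun a b => ⟨fun x => a.fn x + b.fn (x - a.sh), a.sh + b.sh⟩⟩
instance : One (WrG k M) := ⟨⟨fun _ => 0, 0⟩⟩
instance : Inv (WrG k M) := ⟨fun a => ⟨fun x => - a.fn (x + a.sh), - a.sh⟩⟩

@[simp] lemma mul_fn (a b : WrG k M) (x : ZMod k) :
    (a * b).fn x = a.fn x + b.fn (x - a.sh) := rfl
@[simp] lemma mul_sh (a b : WrG k M) : (a * b).sh = a.sh + b.sh := rfl
@[simp] lemma one_fn (x : ZMod k) : (1 : WrG k M).fn x = 0 := rfl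
@[simp] lemma one_sh : (1 : WrG k M).sh = 0 := rfl
@[simp] lemma inv_fn (a : WrG k M) (x : ZMod k) : (a⁻¹).fn x = - a.fn (x + a.sh) := rfl
@[simp] lemma inv_sh (a : WrG k M) : (a⁻¹).sh = - a.sh := rfl

instance : Group (WrG k M) := Group.ofLeftAxioms
  (by
    intro a b c
    ext x
    · simp [add_assoc, sub_sub]
    · simp [add_assoc])
  (by
    intro a
    ext x <;> simp)
  (by
    intro a
    ext x <;> simp)

/-- The underlying set of the group. -/
def equiv (k : ℕ) (M : Type) : WrG k M ≃ (ZMod k → M) × ZMod k where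
  toFun a := (a.fn, a.sh)
  invFun p := ⟨p.1, p.2⟩
  left_inv _ := rfl
  right_inv _ := rfl

/-- The letters used in words. -/
def e (m : M) (s : ZMod k) : WrG k M := ⟨fun x => if x = 0 then m else 0, s⟩

/-- Partial products. -/
def part (h : ZMod k → M) (j : ℕ) (s : ZMod k) : WrG k M :=
  ⟨fun x => if x.val < j then h x else 0, s⟩

lemma part_mul [NeZero k] (h : ZMod k → M) (j : ℕ) (hj : j < k) (s : ZMod k) :
    part h j (j : ZMod k) * e (h (j : ZMod k)) s = part h (j + 1) ((j : ZMod k) + s) := by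
  ext x
  · simp only [part, e, mul_fn, sub_eq_zero]
    have hv : ((j : ZMod k)).val = j := ZMod.val_cast_of_lt hj
    by_cases hx : x = (j : ZMod k)
    · subst hx
      simp [hv]
    · have : x.val ≠ j := fun h' => hx (by rw [← h', ZMod.natCast_zmod_val])
      have h2 : x.val < j + 1 ↔ x.val < j := by omega
      simp [hx, h2]
  · simp [part, e]

lemma word [NeZero k] (h : ZMod k → M) (j : ℕ) (hj : j ≤ k) :
    ((List.range j).map (fun i : ℕ => e (h (i : ZMod k)) (1 : ZMod k))).prod
      = part h j (j : ZMod k) := by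
  induction j with
  | zero => ext x <;> simp [part]
  | succ j ih =>
    rw [List.range_succ, List.map_append, List.prod_append, ih (by omega)]
    simp only [List.map_cons, List.map_nil, List.prod_cons, List.prod_nil, mul_one]
    rw [part_mul h j (by omega)]
    push_cast
    rfl

/-- The normal subgroup of constants in the second component. -/
def Z (k : ℕ) (A R : Type) [AddCommGroup A] [AddCommGroup R] : Subgroup (WrG k (A × R)) where
  carrier := {w | ∃ c : R, w = ⟨fun _ => (0, c), 0⟩}
  mul_mem' := by
    rintro _ _ ⟨c, rfl⟩ ⟨c', rfl⟩
    exact ⟨c + c', by ext x <;> simp⟩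
  one_mem' := ⟨0, by ext x <;> simp⟩
  inv_mem' := by
    rintro _ ⟨c, rfl⟩
    exact ⟨-c, by ext x <;> simp⟩

lemma mem_Z {A R : Type} [AddCommGroup A] [AddCommGroup R] (w : WrG k (A × R)) :
    w ∈ Z k A R ↔ ∃ c : R, w = ⟨fun _ => (0, c), 0⟩ := Iff.rfl

instance {A R : Type} [AddCommGroup A] [AddCommGroup R] : (Z k A R).Normal where
  conj_mem := by
    intro w hw g
    obtain ⟨c, rfl⟩ := (mem_Z w).1 hw
    refine (mem_Z _).2 ⟨c, ?_⟩
    ext x <;> simp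

end WrG

open WrG in
/-- Corollary 4: for any `k ≥ 3` there are arbitrarily large degrees `d` for which
there is a Cayley digraph of diameter at most `k`, outdegree `d`, and order at least
`(1/k)·((k/(k+2))(d+1))^k`. -/
theorem cayley_digraph_second_construction (k : ℕ) (hk : 3 ≤ k) (N : ℕ) :
    ∃ d : ℕ, N ≤ d ∧
      ∃ (G : Type) (_ : Group G) (_ : Fintype G) (S : Finset G),
        S.card = d ∧
        Subgroup.closure (S : Set G) = ⊤ ∧
        (∀ g : G, ∃ l : List G, (∀ x ∈ l, x ∈ S) ∧ l.length ≤ k ∧ l.prod = g) ∧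
        (1 / (k : ℝ)) * (((k : ℝ) / (k + 2)) * (d + 1)) ^ k ≤ (Nat.card G : ℝ) := by
  classical
  have : NeZero k := ⟨by omega⟩
  have : NeZero (k ^ 2) := ⟨by positivity⟩
  let n := N + 1
  let A := ZMod n
  let R := ZMod (k ^ 2)
  let W := WrG k (A × R)
  let Q := W ⧸ Z k A R
  have : Finite W := Finite.of_equiv _ (WrG.equiv k (A × R)).symm
  have : Finite Q := inferInstance
  let S1 : Finset Q := Finset.univ.image (fun m : A × R => ((e m 1 : W) : Q))
  let S2 : Finset Q := Finset.univ.image (fun p : A × ZMod k => ((e (p.1, (0 : R)) p.2 : W) : Q))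
  have hdiam : ∀ g : Q, ∃ l : List Q, (∀ x ∈ l, x ∈ S1 ∪ S2) ∧ l.length ≤ k ∧ l.prod = g := by
    intro g
    obtain ⟨w, rfl⟩ := QuotientGroup.mk_surjective g
    obtain ⟨j, rfl⟩ : ∃ j, k = j + 1 := ⟨k - 1, by omega⟩
    let c : R := (w.fn (j : ZMod (j + 1))).2
    let h : ZMod (j + 1) → A × R := fun x => w.fn x - (0, c)
    let lw : List W := (List.range j).map (fun i : ℕ => e (h (i : ZMod (j+1))) (1 : ZMod (j+1)))
      ++ [e (h (j : ZMod (j+1))) (w.sh - (j : ZMod (j+1)))]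
    have hprod : lw.prod = ⟨h, w.sh⟩ := by
      simp only [lw, List.prod_append, List.prod_cons, List.prod_nil, mul_one]
      rw [word h j (by omega), part_mul h j (by omega)]
      have hx : ∀ x : ZMod (j + 1), x.val < j + 1 := fun x => ZMod.val_lt x
      simp [part, hx]
    refine ⟨lw.map (QuotientGroup.mk' (Z (j+1) A R)), ?_, ?_, ?_⟩
    · intro x hx
      simp only [lw, List.map_append, List.mem_append, List.map_map, List.mem_map] at hx
      rw [Finset.mem_union]
      rcases hx with ⟨i, _, rfl⟩ | ⟨y, hy, rfl⟩
      · left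
        exact Finset.mem_image.2 ⟨h i, Finset.mem_univ _, rfl⟩
      · right
        rw [List.mem_singleton] at hy
        subst hy
        refine Finset.mem_image.2 ⟨((h j).1, w.sh - (j : ZMod (j+1))), Finset.mem_univ _, ?_⟩
        have : h (j : ZMod (j+1)) = ((h (j : ZMod (j+1))).1, (0 : R)) := by
          ext
          · rfl
          · simp [h, c]
        conv_rhs => rw [this]
        rfl
    · simp [lw]
    · rw [← map_list_prod, hprod]
      refine QuotientGroup.eq.2 ((mem_Z _).2 ⟨c, ?_⟩)
      ext x <;> simp [h]
  have hcardle : (S1 ∪ S2).card ≤ n * k ^ 2 + n * k := by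
    refine (Finset.card_union_le _ _).trans (add_le_add ?_ ?_)
    · refine Finset.card_image_le.trans ?_
      simp [A, R, ZMod.card]
    · refine Finset.card_image_le.trans ?_
      simp [A, ZMod.card]
  have hcardge : N ≤ (S1 ∪ S2).card := by
    have h1 : (Finset.univ : Finset A).card ≤ (S1 ∪ S2).card := by
      refine Finset.card_le_card_of_injOn (fun a : A => ((e (a, (0 : R)) (0 : ZMod k) : W) : Q))
        ?_ ?_
      · intro a _
        refine Finset.mem_coe.2 (Finset.mem_union_right _ ?_)
        exact Finset.mem_image.2 ⟨(a, 0), Finset.mem_univ _, rfl⟩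
      · intro a _ b _ hab
        obtain ⟨c, hc⟩ := (mem_Z _).1 (QuotientGroup.eq.1 hab)
        have := congrArg (fun w : W => (w.fn 0).1) hc
        simp [e] at this
        exact (neg_add_eq_zero.1 this)
    have : (Finset.univ : Finset A).card = N + 1 := by simp [A, n, ZMod.card]
    omega
  have hcardW : Nat.card W = (n * k ^ 2) ^ k * k := by
    rw [Nat.card_congr (WrG.equiv k (A × R))]
    simp [A, R, Nat.card_prod, Nat.card_fun, Nat.card_zmod]
  have hcardZ : Nat.card (Z k A R) ≤ k ^ 2 := by
    have : Nat.card R = k ^ 2 := Nat.card_zmod _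
    refine le_trans ?_ this.le
    refine Nat.card_le_card_of_surjective
      (fun c : R => (⟨⟨fun _ => (0, c), 0⟩, c, rfl⟩ : Z k A R)) ?_
    rintro ⟨w, c, rfl⟩
    exact ⟨c, rfl⟩
  have hcardQ : (n * k ^ 2) ^ k * k ≤ Nat.card Q * k ^ 2 := by
    rw [← hcardW, Subgroup.card_eq_card_quotient_mul_card_subgroup (Z k A R)]
    exact Nat.mul_le_mul_left _ hcardZ
  refine ⟨(S1 ∪ S2).card, hcardge, Q, inferInstance, Fintype.ofFinite Q, S1 ∪ S2, rfl, ?_, hdiam, ?_⟩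
  · rw [eq_top_iff]
    intro g _
    obtain ⟨l, hl, _, rfl⟩ := hdiam g
    exact Subgroup.list_prod_mem _ fun x hx => Subgroup.subset_closure (hl x hx)
  · have hk0 : (0 : ℝ) < k := by positivity
    have hn1 : (1 : ℝ) ≤ n := by simp [n]
    have hd : ((S1 ∪ S2).card : ℝ) ≤ n * k ^ 2 + n * k := by exact_mod_cast hcardle
    have hk1 : (3 : ℝ) ≤ k := by exact_mod_cast hk
    have hb : (k : ℝ) / (k + 2) * ((S1 ∪ S2).card + 1) ≤ n * k ^ 2 := by
      rw [div_mul_eq_mul_div, div_le_iff₀ (by positivity)]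
      nlinarith [mul_le_mul hn1 hk1 (by norm_num) (by positivity)]
    have hp : ((k : ℝ) / (k + 2) * ((S1 ∪ S2).card + 1)) ^ k ≤ (n * k ^ 2) ^ k :=
      pow_le_pow_left₀ (by positivity) hb k
    have hq : ((n : ℝ) * k ^ 2) ^ k * k ≤ Nat.card Q * k ^ 2 := by exact_mod_cast hcardQ
    have hq' : ((n : ℝ) * k ^ 2) ^ k ≤ Nat.card Q * k := by
      refine le_of_mul_le_mul_right ?_ hk0
      linarith [hq, show (Nat.card Q : ℝ) * k * k = Nat.card Q * k ^ 2 by ring]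
    rw [one_div, inv_mul_le_iff₀ hk0]
    linarith
end
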